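/- Work in ℝ³ (the Euclidean space EuclideanSpace ℝ (Fin 3)). Let a > 0, z ∈ ℝ³, and let D be a measurable subset of the closed ball of center z and radius a. Let f : ℝ³ → ℂ be measurable with ∫_D |f(y)|² dy < ∞. Then the Newtonian potential N(f)(x) := ∫_D f(y)/(4π‖x−y‖) dy satisfies ∫_D |N(f)(x)|² dx ≤ 4a⁴ · ∫_D |f(y)|² dy. (In particular the operator norm of N on L²(D) is O(a²).) -/

import Mathlib

open MeasureTheory ENNReal

/-- Weighted Cauchy–Schwarz inequality: `(∫ k g)² ≤ (∫ k) (∫ k g²)`. -/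
theorem sq_lintegral_mul_le {α : Type*} [MeasurableSpace α] {μ : Measure α} {k g : α → ℝ≥0∞}
    (hk : AEMeasurable k μ) (hg : AEMeasurable g μ) :
    (∫⁻ y, k y * g y ∂μ) ^ 2 ≤ (∫⁻ y, k y ∂μ) * ∫⁻ y, k y * g y ^ 2 ∂μ := by
  have hsq (t : ℝ≥0∞) : (t ^ (1 / 2 : ℝ)) ^ 2 = t := by
    rw [← ENNReal.rpow_natCast, ← ENNReal.rpow_mul]; norm_num
  have hsq' (t : ℝ≥0∞) : (t ^ 2) ^ (1 / 2 : ℝ) = t := by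
    rw [← ENNReal.rpow_natCast, ← ENNReal.rpow_mul]; norm_num
  have hsplit (y : α) :
      k y * g y = k y ^ (1 / 2 : ℝ) * (k y * g y ^ 2) ^ (1 / 2 : ℝ) := by
    rw [ENNReal.mul_rpow_of_nonneg _ _ (by norm_num), hsq', ← mul_assoc, ← sq, hsq]
  calc (∫⁻ y, k y * g y ∂μ) ^ 2
      = (∫⁻ y, k y ^ (1 / 2 : ℝ) * (k y * g y ^ 2) ^ (1 / 2 : ℝ) ∂μ) ^ 2 := by
        simp_rw [← hsplit]
    _ ≤ ((∫⁻ y, k y ∂μ) ^ (1 / 2 : ℝ) * (∫⁻ y, k y * g y ^ 2 ∂μ) ^ (1 / 2 : ℝ)) ^ 2 := by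
        gcongr
        exact ENNReal.lintegral_mul_norm_pow_le hk (hk.mul (hg.pow_const 2))
          (by norm_num) (by norm_num) (by norm_num)
    _ = _ := by rw [mul_pow, hsq, hsq]

/-- Schur test on `L²`: a nonnegative kernel whose row and column integrals are bounded by `A`
and `B` satisfies `‖K g‖² ≤ A B ‖g‖²`. -/
theorem lintegral_sq_lintegral_mul_le {α β : Type*} [MeasurableSpace α] [MeasurableSpace β]
    {μ : Measure α} {ν : Measure β} [SFinite μ] [SFinite ν] {K : α → β → ℝ≥0∞} {g : β → ℝ≥0∞}
    {A B : ℝ≥0∞} (hK : Measurable (Function.uncurry K)) (hg : Measurable g)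
    (hrow : ∀ᵐ x ∂μ, ∫⁻ y, K x y ∂ν ≤ A) (hcol : ∀ᵐ y ∂ν, ∫⁻ x, K x y ∂μ ≤ B) :
    ∫⁻ x, (∫⁻ y, K x y * g y ∂ν) ^ 2 ∂μ ≤ A * B * ∫⁻ y, g y ^ 2 ∂ν := by
  have hKg : Measurable (Function.uncurry fun x y => K x y * g y ^ 2) :=
    hK.mul ((hg.comp measurable_snd).pow_const 2)
  calc ∫⁻ x, (∫⁻ y, K x y * g y ∂ν) ^ 2 ∂μ
      ≤ ∫⁻ x, A * ∫⁻ y, K x y * g y ^ 2 ∂ν ∂μ := by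
        refine lintegral_mono_ae ?_
        filter_upwards [hrow] with x hx
        exact (sq_lintegral_mul_le hK.of_uncurry_left.aemeasurable hg.aemeasurable).trans
          (by gcongr)
    _ = A * ∫⁻ y, ∫⁻ x, K x y * g y ^ 2 ∂μ ∂ν := by
        rw [lintegral_const_mul _ hKg.lintegral_prod_right,
          lintegral_lintegral_swap hKg.aemeasurable]
    _ ≤ A * ∫⁻ y, B * g y ^ 2 ∂ν := by
        gcongr A * ?_
        refine lintegral_mono_ae ?_
        filter_upwards [hcol] with y hy
        rw [lintegral_mul_const _ hK.of_uncurry_right]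
        gcongr
    _ = A * B * ∫⁻ y, g y ^ 2 ∂ν := by
        rw [lintegral_const_mul _ (hg.pow_const 2), mul_assoc]

/-- The integral of `1 / (4π‖y‖)` over the ball of radius `R` in `ℝ³` is `R² / 2`. -/
theorem lintegral_closedBall_newtonian_kernel {R : ℝ} (hR : 0 ≤ R) :
    ∫⁻ y in Metric.closedBall (0 : EuclideanSpace ℝ (Fin 3)) R,
      ENNReal.ofReal (1 / (4 * Real.pi * ‖y‖)) = ENNReal.ofReal (R ^ 2 / 2) := by
  set φ : ℝ → ℝ := (Set.Iic R).indicator fun r => 1 / (4 * Real.pi * r) with hφ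
  have hradial : Set.EqOn (fun r : ℝ => r ^ 2 • φ r)
      ((Set.Iic R).indicator fun r => r / (4 * Real.pi)) (Set.Ioi 0) := by
    intro r hr
    have hr0 : r ≠ 0 := (Set.mem_Ioi.1 hr).ne'
    by_cases hrR : r ≤ R
    · simp only [hφ, smul_eq_mul, Set.indicator_of_mem (Set.mem_Iic.2 hrR)]
      field_simp
    · simp [hφ, hrR]
  have hinter : Set.Ioi (0 : ℝ) ∩ Set.Iic R = Set.Ioc 0 R := rfl
  have hint : Integrable (fun y : EuclideanSpace ℝ (Fin 3) => φ ‖y‖) := by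
    rw [integrable_fun_norm_addHaar volume (f := φ), finrank_euclideanSpace_fin,
      integrableOn_congr_fun hradial measurableSet_Ioi, IntegrableOn,
      integrable_indicator_iff measurableSet_Iic, IntegrableOn,
      Measure.restrict_restrict measurableSet_Iic, Set.inter_comm, hinter]
    exact ((by fun_prop : Continuous fun r : ℝ => r / (4 * Real.pi)).integrableOn_Ioc)
  have hval : ∫ y : EuclideanSpace ℝ (Fin 3), φ ‖y‖ = R ^ 2 / 2 := by
    rw [integral_fun_norm_addHaar volume φ, finrank_euclideanSpace_fin,
      setIntegral_congr_fun measurableSet_Ioi hradial,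
      setIntegral_indicator measurableSet_Iic, hinter,
      ← intervalIntegral.integral_of_le hR, intervalIntegral.integral_div, integral_id,
      Measure.real, EuclideanSpace.volume_ball_fin_three]
    have hπ := Real.pi_pos
    rw [ENNReal.ofReal_one, one_pow, one_mul, ENNReal.toReal_ofReal (by positivity)]
    simp only [nsmul_eq_mul, smul_eq_mul]
    field_simp
    norm_num
  have hnonneg : ∀ y : EuclideanSpace ℝ (Fin 3), 0 ≤ φ ‖y‖ := fun y =>
    Set.indicator_apply_nonneg fun _ => by positivity
  rw [← hval, ofReal_integral_eq_lintegral_ofReal hint (ae_of_all _ hnonneg),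
    ← lintegral_indicator Metric.isClosed_closedBall.measurableSet]
  refine lintegral_congr fun y => ?_
  by_cases hy : ‖y‖ ≤ R <;> simp [hφ, hy]

/-- The kernel `1 / (4π‖x - y‖)` integrates to at most `2a²` over any subset of a ball of
radius `a` containing `x`. -/
theorem setLIntegral_newtonian_kernel_le {a : ℝ} (ha : 0 ≤ a) {x z : EuclideanSpace ℝ (Fin 3)}
    {D : Set (EuclideanSpace ℝ (Fin 3))} (hD : D ⊆ Metric.closedBall z a) (hx : x ∈ D) :
    ∫⁻ y in D, ENNReal.ofReal (1 / (4 * Real.pi * ‖x - y‖)) ≤ ENNReal.ofReal (2 * a ^ 2) := by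
  have hsub : D ⊆ (fun y => x - y) ⁻¹' Metric.closedBall 0 (2 * a) := by
    intro y hy
    have hxz := hD hx
    have hyz := hD hy
    rw [Metric.mem_closedBall] at hxz hyz
    rw [Set.mem_preimage, mem_closedBall_zero_iff, ← dist_eq_norm]
    linarith [dist_triangle_right x y z]
  calc ∫⁻ y in D, ENNReal.ofReal (1 / (4 * Real.pi * ‖x - y‖))
      ≤ ∫⁻ y in (fun y => x - y) ⁻¹' Metric.closedBall 0 (2 * a),
          ENNReal.ofReal (1 / (4 * Real.pi * ‖x - y‖)) := lintegral_mono_set hsub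
    _ = ∫⁻ y in Metric.closedBall (0 : EuclideanSpace ℝ (Fin 3)) (2 * a),
          ENNReal.ofReal (1 / (4 * Real.pi * ‖y‖)) :=
        (Measure.measurePreserving_sub_left volume x).setLIntegral_comp_preimage
          (f := fun y => ENNReal.ofReal (1 / (4 * Real.pi * ‖y‖)))
          Metric.isClosed_closedBall.measurableSet (by fun_prop)
    _ = ENNReal.ofReal (2 * a ^ 2) := by
        rw [lintegral_closedBall_newtonian_kernel (by positivity)]
        congr 1
        ring

/-- `L²(D) → L²(D)` bound for the Newtonian potential `N(f)(x) = ∫_D f(y)/(4π‖x−y‖) dy`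
on a set `D` contained in a ball of radius `a`: `‖N f‖²_{L²(D)} ≤ 4 a⁴ ‖f‖²_{L²(D)}`. -/
theorem stmt10 (a : ℝ) (ha : 0 < a) (z : EuclideanSpace ℝ (Fin 3))
    (D : Set (EuclideanSpace ℝ (Fin 3))) (hDm : MeasurableSet D)
    (hDsub : D ⊆ Metric.closedBall z a)
    (f : EuclideanSpace ℝ (Fin 3) → ℂ) (hf : Measurable f)
    (hfL2 : ∫⁻ y in D, (‖f y‖₊ : ℝ≥0∞) ^ 2 < ⊤) :
    ∫⁻ x in D, (‖∫ y in D, f y / ((4 * Real.pi * ‖x - y‖ : ℝ) : ℂ)‖₊ : ℝ≥0∞) ^ 2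
      ≤ ENNReal.ofReal (4 * a ^ 4) * ∫⁻ y in D, (‖f y‖₊ : ℝ≥0∞) ^ 2 := by
  have hK : Measurable (Function.uncurry fun x y : EuclideanSpace ℝ (Fin 3) =>
      ENNReal.ofReal (1 / (4 * Real.pi * ‖x - y‖))) := by
    unfold Function.uncurry
    fun_prop
  have hrow : ∀ᵐ x ∂volume.restrict D,
      ∫⁻ y in D, ENNReal.ofReal (1 / (4 * Real.pi * ‖x - y‖)) ≤ ENNReal.ofReal (2 * a ^ 2) :=
    (ae_restrict_mem hDm).mono fun x hx => setLIntegral_newtonian_kernel_le ha.le hDsub hx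
  have hcol : ∀ᵐ y ∂volume.restrict D,
      ∫⁻ x in D, ENNReal.ofReal (1 / (4 * Real.pi * ‖x - y‖)) ≤ ENNReal.ofReal (2 * a ^ 2) := by
    simpa only [norm_sub_rev] using hrow
  have hpoint (x : EuclideanSpace ℝ (Fin 3)) :
      (‖∫ y in D, f y / ((4 * Real.pi * ‖x - y‖ : ℝ) : ℂ)‖₊ : ℝ≥0∞) ≤
        ∫⁻ y in D, ENNReal.ofReal (1 / (4 * Real.pi * ‖x - y‖)) * (‖f y‖₊ : ℝ≥0∞) := by
    refine (enorm_integral_le_lintegral_enorm _).trans_eq (lintegral_congr fun y => ?_)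
    have hnonneg : 0 ≤ 4 * Real.pi * ‖x - y‖ := by positivity
    rw [← ofReal_norm, norm_div, Complex.norm_real, Real.norm_of_nonneg hnonneg,
      ← enorm_eq_nnnorm, ← ofReal_norm, ← ENNReal.ofReal_mul (by positivity)]
    congr 1
    ring
  calc _ ≤ ∫⁻ x in D, (∫⁻ y in D,
        ENNReal.ofReal (1 / (4 * Real.pi * ‖x - y‖)) * (‖f y‖₊ : ℝ≥0∞)) ^ 2 := by
        gcongr with x
        exact hpoint x
    _ ≤ ENNReal.ofReal (2 * a ^ 2) * ENNReal.ofReal (2 * a ^ 2) *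
          ∫⁻ y in D, (‖f y‖₊ : ℝ≥0∞) ^ 2 :=
        lintegral_sq_lintegral_mul_le hK (by fun_prop) hrow hcol
    _ = _ := by
        rw [← ENNReal.ofReal_mul (by positivity)]
        congr 2
        ring
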